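/- Let τ be an ℵ₀-tangle of G such that U(τ,X) is non-principal for at least one finite set X of vertices. Then the set 𝒳_τ = {X ⊆ V : X finite and U(τ,X) non-principal} has a least element X_τ under set inclusion, and 𝒳_τ = {X ⊆ V : X finite and X_τ ⊆ X}. -/

import Mathlib

open Set

variable {V : Type*}

/-- `{A,B}` is a separation of `G`: `A ∪ B = V` and no edge between `A∖B` and `B∖A`. -/
def IsSep (G : SimpleGraph V) (A B : Set V) : Prop :=
  A ∪ B = Set.univ ∧ ∀ a ∈ A \ B, ∀ b ∈ B \ A, ¬ G.Adj a b

/-- A separation of finite order. -/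
def IsFinSep (G : SimpleGraph V) (A B : Set V) : Prop :=
  IsSep G A B ∧ (A ∩ B).Finite

/-- The set `S⃗` of oriented finite-order separations of `G`, as ordered pairs. -/
def Svec (G : SimpleGraph V) : Set (Set V × Set V) :=
  {p | IsFinSep G p.1 p.2}

/-- `(A,B) ≤ (C,D)` iff `A ⊆ C` and `D ⊆ B`. -/
def sepLE (p q : Set V × Set V) : Prop :=
  p.1 ⊆ q.1 ∧ q.2 ⊆ p.2

/-- An orientation of the set `S` of finite-order separations: a subset of `S⃗` containing
exactly one of `(A,B)`, `(B,A)` for every finite-order separation `{A,B}`. -/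
def IsOrientation (G : SimpleGraph V) (O : Set (Set V × Set V)) : Prop :=
  O ⊆ Svec G ∧ ∀ A B : Set V, IsFinSep G A B → ((A, B) ∈ O ↔ (B, A) ∉ O)

/-- Consistency: no two distinct members `(B,A)`, `(C,D)` with `(A,B) < (C,D)`. -/
def Consistent (O : Set (Set V × Set V)) : Prop :=
  ∀ A B C D : Set V, (B, A) ∈ O → (C, D) ∈ O → (B, A) ≠ (C, D) →
    ¬ (sepLE (A, B) (C, D) ∧ (A, B) ≠ (C, D))

/-- A star in `S⃗`: every two distinct elements point towards each other. -/
def IsStar (G : SimpleGraph V) (σ : Set (Set V × Set V)) : Prop :=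
  σ ⊆ Svec G ∧ ∀ p ∈ σ, ∀ q ∈ σ, p ≠ q → sepLE p (q.2, q.1)

/-- Membership in `T_n`: a star of at most `n` elements whose target sides have finite
intersection. -/
def InTn (G : SimpleGraph V) (n : ℕ) (σ : Set (Set V × Set V)) : Prop :=
  IsStar G σ ∧ σ.Finite ∧ σ.ncard ≤ n ∧ (⋂ p ∈ σ, p.2).Finite

/-- Membership in `T`: an arbitrary star whose target sides have finite intersection. -/
def InT (G : SimpleGraph V) (σ : Set (Set V × Set V)) : Prop :=
  IsStar G σ ∧ (⋂ p ∈ σ, p.2).Finite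

/-- An `ℵ₀`-tangle of `G`: a consistent orientation of `S` with no subset in `T₃`. -/
def IsTangle (G : SimpleGraph V) (τ : Set (Set V × Set V)) : Prop :=
  IsOrientation G τ ∧ Consistent τ ∧ ∀ σ ⊆ τ, ¬ InTn G 3 σ

/-- A `T`-tangle of `S`: a consistent orientation of `S` with no subset in `T`. -/
def IsTTangle (G : SimpleGraph V) (τ : Set (Set V × Set V)) : Prop :=
  IsOrientation G τ ∧ Consistent τ ∧ ∀ σ ⊆ τ, ¬ InT G σ

/-- The set `𝒞_X` of (vertex sets of) connected components of `G − X`. -/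
def Comps (G : SimpleGraph V) (X : Set V) : Set (Set V) :=
  {C | ∃ c : (G.induce Xᶜ).ConnectedComponent, C = Subtype.val '' c.supp}

/-- A collection of subsets of `α` is an ultrafilter on `α`. -/
def IsUltra {α : Type*} (F : Set (Set α)) : Prop :=
  ∅ ∉ F ∧ (∀ s ∈ F, ∀ t ∈ F, s ∩ t ∈ F) ∧ (∀ s ∈ F, ∀ t : Set α, s ⊆ t → t ∈ F) ∧
    ∀ s : Set α, s ∈ F ∨ sᶜ ∈ F

/-- A principal ultrafilter, generated by a single point. -/
def IsPrincipalUF {α : Type*} (F : Set (Set α)) : Prop :=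
  ∃ a : α, F = {s | a ∈ s}

/-- `U(τ,X)`: the collection of all sets `𝒮` of components of `G − X` with
`(⋃(𝒞_X∖𝒮) ∪ X, ⋃𝒮 ∪ X) ∈ τ`. -/
def tangleUF (G : SimpleGraph V) (τ : Set (Set V × Set V)) (X : Set V) :
    Set (Set ↥(Comps G X)) :=
  {𝒮 | ((⋃ C ∈ 𝒮ᶜ, (C : Set V)) ∪ X, (⋃ C ∈ 𝒮, (C : Set V)) ∪ X) ∈ τ}

/-- `f_{X',X}`: the pushforward of an ultrafilter on `𝒞_{X'}` along the map sending each
component of `G − X'` to the component of `G − X` containing it. -/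
def pushUF (G : SimpleGraph V) (X X' : Set V) (F : Set (Set ↥(Comps G X'))) :
    Set (Set ↥(Comps G X)) :=
  {𝒮 | {C' : ↥(Comps G X') | ∃ C ∈ 𝒮, (C' : Set V) ⊆ (C : Set V)} ∈ F}

/-- A direction in `G`: a choice of a component of `G − X` for every finite `X ⊆ V`,
compatible under inclusion. -/
def IsDirection (G : SimpleGraph V) (f : Set V → Set V) : Prop :=
  (∀ X : Set V, X.Finite → f X ∈ Comps G X) ∧
    ∀ X X' : Set V, X.Finite → X'.Finite → X ⊆ X' → f X' ⊆ f X

/-- The vertex set of the component of `G − X` containing `v` (empty if `v ∈ X`). -/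
def compOf (G : SimpleGraph V) (X : Set V) (v : V) : Set V :=
  {w | ∃ (hv : v ∈ Xᶜ) (hw : w ∈ Xᶜ), (G.induce Xᶜ).Reachable ⟨v, hv⟩ ⟨w, hw⟩}

theorem mem_compOf_self (G : SimpleGraph V) {X : Set V} {v : V} (hv : v ∉ X) :
    v ∈ compOf G X v :=
  ⟨hv, hv, SimpleGraph.Reachable.refl _⟩

theorem mem_compOf_of_adj {G : SimpleGraph V} {X : Set V} {v w z : V}
    (hw : w ∈ compOf G X v) (hz : z ∉ X) (h : G.Adj w z) : z ∈ compOf G X v := by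
  obtain ⟨hv, hw', hr⟩ := hw
  have hadj : (G.induce Xᶜ).Adj ⟨w, hw'⟩ ⟨z, hz⟩ := h
  exact ⟨hv, hz, hr.trans hadj.reachable⟩

/-- A property of the base point that propagates along edges of `G − X` holds on its
component. -/
theorem compOf_induction {G : SimpleGraph V} {X : Set V} {v : V} {P : V → Prop} (h0 : P v)
    (hstep : ∀ a b, a ∉ X → b ∉ X → G.Adj a b → P a → P b) {w : V}
    (hw : w ∈ compOf G X v) : P w := by
  obtain ⟨hv, hw', ⟨p⟩⟩ := hw
  have key : ∀ (a b : ↥(Xᶜ : Set V)), (G.induce Xᶜ).Walk a b → P a → P b := by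
    intro a b p
    induction p with
    | nil => exact id
    | @cons a b _ hadj _ ih => exact fun ha => ih (hstep a b a.2 b.2 hadj ha)
  exact key _ _ p h0

theorem mem_Comps_iff {G : SimpleGraph V} {X C : Set V} :
    C ∈ Comps G X ↔ ∃ v ∉ X, C = compOf G X v := by
  have key : ∀ (v : V) (hv : v ∈ Xᶜ),
      Subtype.val '' ((G.induce Xᶜ).connectedComponentMk ⟨v, hv⟩).supp = compOf G X v := by
    intro v hv
    ext w
    constructor
    · rintro ⟨⟨w, hw⟩, hmem, rfl⟩
      exact ⟨hv, hw, (SimpleGraph.ConnectedComponent.exact hmem).symm⟩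
    · rintro ⟨_, hw, hr⟩
      exact ⟨⟨w, hw⟩, SimpleGraph.ConnectedComponent.sound hr.symm, rfl⟩
  constructor
  · rintro ⟨c, rfl⟩
    induction c using SimpleGraph.ConnectedComponent.ind with
    | h v => exact ⟨v, v.2, key v v.2⟩
  · rintro ⟨v, hv, rfl⟩
    exact ⟨_, (key v hv).symm⟩

theorem Comps_eq_of_mem {G : SimpleGraph V} {X C D : Set V} (hC : C ∈ Comps G X)
    (hD : D ∈ Comps G X) {v : V} (hvC : v ∈ C) (hvD : v ∈ D) : C = D := by
  obtain ⟨a, -, rfl⟩ := mem_Comps_iff.1 hC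
  obtain ⟨b, -, rfl⟩ := mem_Comps_iff.1 hD
  obtain ⟨ha, hv, hav⟩ := hvC
  obtain ⟨hb, hv', hbv⟩ := hvD
  ext w
  constructor
  · rintro ⟨_, hw, h⟩
    exact ⟨hb, hw, (hbv.trans hav.symm).trans h⟩
  · rintro ⟨_, hw, h⟩
    exact ⟨ha, hw, (hav.trans hbv.symm).trans h⟩

theorem IsFinSep.symm {G : SimpleGraph V} {A B : Set V} (h : IsFinSep G A B) :
    IsFinSep G B A :=
  ⟨⟨by rw [union_comm]; exact h.1.1, fun a ha b hb hab => h.1.2 b hb a ha hab.symm⟩,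
    by rw [inter_comm]; exact h.2⟩

theorem IsFinSep.sup {G : SimpleGraph V} {A B C D : Set V} (h : IsFinSep G A B)
    (h' : IsFinSep G C D) : IsFinSep G (A ∪ C) (B ∩ D) := by
  refine ⟨⟨?_, ?_⟩, (h.2.union h'.2).subset ?_⟩
  · ext v
    have h1 : v ∈ A ∪ B := h.1.1 ▸ mem_univ v
    have h2 : v ∈ C ∪ D := h'.1.1 ▸ mem_univ v
    simp only [mem_union, mem_inter_iff, mem_univ, iff_true] at *
    tauto
  · rintro a ⟨ha, ha'⟩ b ⟨hb, hb'⟩ hab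
    have h1 : a ∈ A ∪ B := h.1.1 ▸ mem_univ a
    have h2 : a ∈ C ∪ D := h'.1.1 ▸ mem_univ a
    have h3 := h.1.2 a
    have h4 := h'.1.2 a
    simp only [mem_union, mem_inter_iff, mem_sdiff] at *
    by_cases haB : a ∈ B
    · exact h4 ⟨by tauto, by tauto⟩ b ⟨by tauto, by tauto⟩ hab
    · exact h3 ⟨by tauto, by tauto⟩ b ⟨by tauto, by tauto⟩ hab
  · intro v hv
    simp only [mem_union, mem_inter_iff] at *
    tauto

namespace IsTangle

variable {G : SimpleGraph V} {τ : Set (Set V × Set V)}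

theorem isFinSep (hτ : IsTangle G τ) {A B : Set V} (h : (A, B) ∈ τ) : IsFinSep G A B :=
  hτ.1.1 h

theorem infinite_right (hτ : IsTangle G τ) {A B : Set V} (h : (A, B) ∈ τ) : B.Infinite := by
  intro hB
  refine hτ.2.2 {(A, B)} (by simpa using h) ⟨⟨by simpa using hτ.1.1 h, ?_⟩, by simp, by simp, ?_⟩
  · rintro p rfl q rfl hne
    exact absurd rfl hne
  · simpa using hB

theorem mem_of_finite_left (hτ : IsTangle G τ) {A B : Set V} (h : IsFinSep G A B)
    (hA : A.Finite) : (A, B) ∈ τ :=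
  (hτ.1.2 A B h).2 fun h' => hτ.infinite_right h' hA

theorem mem_of_le (hτ : IsTangle G τ) {A B C D : Set V} (h : IsFinSep G A B)
    (hCD : (C, D) ∈ τ) (hAC : A ⊆ C) (hDB : D ⊆ B) : (A, B) ∈ τ := by
  rw [hτ.1.2 A B h]
  intro hBA
  have hne : (A, B) ≠ (C, D) := fun he => (hτ.1.2 A B h).1 (he ▸ hCD) hBA
  by_cases he : (B, A) = (C, D)
  · obtain ⟨rfl, rfl⟩ := Prod.mk.inj he
    exact hτ.infinite_right hBA (h.2.subset fun v hv => ⟨hv, hAC hv⟩)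
  · exact hτ.2.1 A B C D hBA hCD he ⟨⟨hAC, hDB⟩, hne⟩

theorem sup_mem (hτ : IsTangle G τ) {A B C D : Set V} (h : (A, B) ∈ τ) (h' : (C, D) ∈ τ) :
    (A ∪ C, B ∩ D) ∈ τ := by
  have hs := hτ.isFinSep h
  have hs' := hτ.isFinSep h'
  rw [hτ.1.2 _ _ (hs.sup hs')]
  intro hinv
  have hmid : (B ∩ C, A ∪ D) ∈ τ :=
    hτ.mem_of_le (hs.sup hs'.symm).symm h' inter_subset_right subset_union_right
  have hsub : ({(A, B), (B ∩ C, A ∪ D), (B ∩ D, A ∪ C)} : Set (Set V × Set V)) ⊆ τ := by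
    rintro p (rfl | rfl | rfl) <;> assumption
  refine hτ.2.2 _ hsub ⟨⟨hsub.trans hτ.1.1, ?_⟩, by simp, ?_, ?_⟩
  · rintro p (rfl | rfl | rfl) q (rfl | rfl | rfl) hne <;>
      first
      | exact absurd rfl hne
      | (constructor <;> intro v hv <;> simp only [mem_union, mem_inter_iff] at * <;> tauto)
  · exact (ncard_insert_le _ _).trans (Nat.succ_le_succ (ncard_insert_le _ _)) |>.trans (by simp)
  · refine (hs.2.union hs'.2).subset fun v hv => ?_
    simp only [mem_insert_iff, mem_singleton_iff, iInter_iInter_eq_or_left, iInter_iInter_eq_left,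
      mem_union, mem_inter_iff] at *
    tauto

/-- The filter of all sets containing, up to finitely many vertices, the big side of a
separation in the tangle. -/
def sideFilter [Infinite V] (hτ : IsTangle G τ) : Filter V where
  sets := {W | ∃ A B, (A, B) ∈ τ ∧ (B \ W).Finite}
  univ_sets := ⟨∅, univ, hτ.mem_of_finite_left ⟨⟨by simp, by simp⟩, by simp⟩ finite_empty,
    by simp⟩
  sets_of_superset := by
    rintro W W' ⟨A, B, h, hf⟩ hW
    exact ⟨A, B, h, hf.subset (sdiff_subset_sdiff_right hW)⟩
  inter_sets := by
    rintro W W' ⟨A, B, h, hf⟩ ⟨C, D, h', hf'⟩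
    refine ⟨_, _, hτ.sup_mem h h', (hf.union hf').subset ?_⟩
    intro v hv
    simp only [mem_union, mem_inter_iff, mem_sdiff] at *
    tauto

/-- Every `ℵ₀`-tangle is induced by a free ultrafilter on the vertex set. -/
theorem exists_ultrafilter [Infinite V] (hτ : IsTangle G τ) :
    ∃ u : Ultrafilter V, (∀ F : Set V, F.Finite → F ∉ u) ∧
      ∀ A B, IsFinSep G A B → ((A, B) ∈ τ ↔ B ∈ u) := by
  have hne : hτ.sideFilter.NeBot := by
    refine ⟨fun hbot => ?_⟩
    have : (∅ : Set V) ∈ hτ.sideFilter := hbot ▸ Filter.mem_bot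
    obtain ⟨A, B, h, hf⟩ := this
    exact hτ.infinite_right h (by simpa using hf)
  obtain ⟨u, hu⟩ := Ultrafilter.exists_le hτ.sideFilter
  have hfree : ∀ F : Set V, F.Finite → F ∉ u := by
    intro F hF hFu
    refine Ultrafilter.compl_notMem_iff.2 hFu (hu ?_)
    exact ⟨∅, univ, hτ.mem_of_finite_left ⟨⟨by simp, by simp⟩, by simp⟩ finite_empty,
      hF.subset fun v hv => by simpa using hv⟩
  have hmem : ∀ A B, (A, B) ∈ τ → B ∈ u := fun A B h => hu ⟨A, B, h, by simp⟩
  refine ⟨u, hfree, fun A B h => ⟨hmem A B, fun hB => ?_⟩⟩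
  rw [hτ.1.2 A B h]
  exact fun h' => hfree _ h.2 (Filter.inter_mem (hmem B A h') hB)

end IsTangle

theorem isFinSep_of_comps (G : SimpleGraph V) {X : Set V} (hX : X.Finite)
    (𝒮 : Set ↥(Comps G X)) :
    IsFinSep G ((⋃ C ∈ 𝒮ᶜ, (C : Set V)) ∪ X) ((⋃ C ∈ 𝒮, (C : Set V)) ∪ X) := by
  refine ⟨⟨?_, ?_⟩, hX.subset ?_⟩
  · refine eq_univ_of_forall fun v => ?_
    by_cases hv : v ∈ X
    · exact Or.inl (Or.inr hv)
    · by_cases hC : (⟨compOf G X v, mem_Comps_iff.2 ⟨v, hv, rfl⟩⟩ : ↥(Comps G X)) ∈ 𝒮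
      · exact Or.inr (Or.inl (mem_biUnion hC (mem_compOf_self G hv)))
      · exact Or.inl (Or.inl (mem_biUnion (mem_compl hC) (mem_compOf_self G hv)))
  · rintro a ⟨ha, ha'⟩ b ⟨hb, hb'⟩ hab
    have haX : a ∉ X := fun h => ha' (Or.inr h)
    have hbX : b ∉ X := fun h => hb' (Or.inr h)
    obtain ⟨C, hC, haC⟩ := mem_iUnion₂.1 (ha.resolve_right haX)
    refine hb' (Or.inl (mem_biUnion hC ?_))
    obtain ⟨v, -, hv⟩ := mem_Comps_iff.1 C.2
    rw [hv] at haC ⊢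
    exact mem_compOf_of_adj haC hbX hab
  · rintro v ⟨hv | hv, hv' | hv'⟩
    · obtain ⟨C, hC, hvC⟩ := mem_iUnion₂.1 hv
      obtain ⟨D, hD, hvD⟩ := mem_iUnion₂.1 hv'
      exact absurd (Subtype.ext (Comps_eq_of_mem C.2 D.2 hvC hvD) ▸ hD) hC
    all_goals assumption

/-- For the tangle induced by a free ultrafilter `u`, the ultrafilter `U(τ,X)` is principal
exactly when `u` contains a component of `G − X`. -/
theorem isPrincipalUF_tangleUF_iff {G : SimpleGraph V} {τ : Set (Set V × Set V)}
    {u : Ultrafilter V} (hfree : ∀ F : Set V, F.Finite → F ∉ u)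
    (hu : ∀ A B, IsFinSep G A B → ((A, B) ∈ τ ↔ B ∈ u)) {X : Set V} (hX : X.Finite) :
    IsPrincipalUF (tangleUF G τ X) ↔ ∃ v, compOf G X v ∈ u := by
  have hmem : ∀ 𝒮 : Set ↥(Comps G X), 𝒮 ∈ tangleUF G τ X ↔ (⋃ C ∈ 𝒮, (C : Set V)) ∈ u := by
    intro 𝒮
    refine (hu _ _ (isFinSep_of_comps G hX 𝒮)).trans ?_
    rw [Ultrafilter.union_mem_iff]
    exact or_iff_left (hfree X hX)
  constructor
  · rintro ⟨C, hC⟩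
    obtain ⟨v, -, hv⟩ := mem_Comps_iff.1 C.2
    have : ({C} : Set ↥(Comps G X)) ∈ tangleUF G τ X := hC ▸ mem_singleton C
    rw [hmem, biUnion_singleton, hv] at this
    exact ⟨v, this⟩
  · rintro ⟨v, hv⟩
    obtain ⟨w, hw⟩ := u.nonempty_of_mem hv
    refine ⟨⟨compOf G X v, mem_Comps_iff.2 ⟨v, hw.1, rfl⟩⟩, ?_⟩
    ext 𝒮
    rw [hmem]
    constructor
    · intro h𝒮
      obtain ⟨z, hz, hzv⟩ := u.nonempty_of_mem (Filter.inter_mem h𝒮 hv)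
      obtain ⟨C, hC, hzC⟩ := mem_iUnion₂.1 hz
      have : C = ⟨compOf G X v, mem_Comps_iff.2 ⟨v, hw.1, rfl⟩⟩ :=
        Subtype.ext (Comps_eq_of_mem C.2 (mem_Comps_iff.2 ⟨v, hw.1, rfl⟩) hzC hzv)
      exact this ▸ hC
    · exact fun h𝒮 => Filter.mem_of_superset hv fun z hz => mem_biUnion h𝒮 hz

theorem compOf_anti (G : SimpleGraph V) {X Y : Set V} (hXY : X ⊆ Y) (v : V) :
    compOf G Y v ⊆ compOf G X v := by
  intro w hw
  exact compOf_induction (P := fun w => w ∈ compOf G X v)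
    (mem_compOf_self G fun h => hw.1 (hXY h))
    (fun a b _ hb hab ha => mem_compOf_of_adj ha (fun h => hb (hXY h)) hab) hw

/-- A component of `G − (X ∩ Y)` is covered by `X ∪ Y`, the components of `G − X` meeting `Y`,
those of `G − Y` meeting `X`, and one further component of `G − X`. -/
theorem compOf_inter_subset (G : SimpleGraph V) (X Y : Set V) (v : V) :
    compOf G (X ∩ Y) v ⊆ (X ∪ Y) ∪ ((⋃ y ∈ insert v Y, compOf G X y) ∪ ⋃ x ∈ X, compOf G Y x) := by
  intro w hw
  refine compOf_induction (P := fun w =>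
    w ∈ (X ∪ Y) ∪ ((⋃ y ∈ insert v Y, compOf G X y) ∪ ⋃ x ∈ X, compOf G Y x)) ?_ ?_ hw
  · by_cases hv : v ∈ X
    · exact Or.inl (Or.inl hv)
    · exact Or.inr (Or.inl (mem_biUnion (mem_insert v Y) (mem_compOf_self G hv)))
  · intro a b ha _ hab hPa
    by_cases hbX : b ∈ X
    · exact Or.inl (Or.inl hbX)
    by_cases hbY : b ∈ Y
    · exact Or.inl (Or.inr hbY)
    rcases hPa with (haX | haY) | h | h
    · exact Or.inr (Or.inr (mem_biUnion haX
        (mem_compOf_of_adj (mem_compOf_self G fun haY => ha ⟨haX, haY⟩) hbY hab)))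
    · exact Or.inr (Or.inl (mem_biUnion (mem_insert_of_mem v haY)
        (mem_compOf_of_adj (mem_compOf_self G fun haX => ha ⟨haX, haY⟩) hbX hab)))
    · obtain ⟨y, hy, hay⟩ := mem_iUnion₂.1 h
      exact Or.inr (Or.inl (mem_biUnion hy (mem_compOf_of_adj hay hbX hab)))
    · obtain ⟨x, hx, hax⟩ := mem_iUnion₂.1 h
      exact Or.inr (Or.inr (mem_biUnion hx (mem_compOf_of_adj hax hbY hab)))

/-- If a free ultrafilter contains a component of `G − (X ∩ Y)`, then it contains a component
of `G − X` or of `G − Y`. -/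
theorem exists_compOf_mem_of_inter {G : SimpleGraph V} {u : Ultrafilter V}
    (hfree : ∀ F : Set V, F.Finite → F ∉ u) {X Y : Set V} (hX : X.Finite) (hY : Y.Finite)
    {v : V} (hv : compOf G (X ∩ Y) v ∈ u) :
    (∃ w, compOf G X w ∈ u) ∨ ∃ w, compOf G Y w ∈ u := by
  have h := Filter.mem_of_superset hv (compOf_inter_subset G X Y v)
  rcases Ultrafilter.union_mem_iff.1 h with h | h
  · exact absurd h (hfree _ (hX.union hY))
  rcases Ultrafilter.union_mem_iff.1 h with h | h
  · obtain ⟨y, -, hy⟩ := (Ultrafilter.finite_biUnion_mem_iff (hY.insert v)).1 h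
    exact Or.inl ⟨y, hy⟩
  · obtain ⟨x, -, hx⟩ := (Ultrafilter.finite_biUnion_mem_iff hX).1 h
    exact Or.inr ⟨x, hx⟩

/-- Theorem 3.6: if `U(τ,X)` is non-principal for some finite `X`, then
the set `𝒳_τ` of such `X` has a least element `X_τ`, and `𝒳_τ` is its up-closure. -/
theorem stmt15 [Infinite V] (G : SimpleGraph V) (τ : Set (Set V × Set V))
    (hτ : IsTangle G τ)
    (h : ∃ X : Set V, X.Finite ∧ ¬ IsPrincipalUF (tangleUF G τ X)) :
    ∃ X₀ : Set V, X₀.Finite ∧ ¬ IsPrincipalUF (tangleUF G τ X₀) ∧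
      (∀ X : Set V, X.Finite → ¬ IsPrincipalUF (tangleUF G τ X) → X₀ ⊆ X) ∧
      {X : Set V | X.Finite ∧ ¬ IsPrincipalUF (tangleUF G τ X)} =
        {X : Set V | X.Finite ∧ X₀ ⊆ X} := by
  obtain ⟨u, hfree, hu⟩ := hτ.exists_ultrafilter
  have hiff : ∀ X : Set V, X.Finite →
      (IsPrincipalUF (tangleUF G τ X) ↔ ∃ v, compOf G X v ∈ u) :=
    fun X hX => isPrincipalUF_tangleUF_iff hfree hu hX
  obtain ⟨X₀, ⟨hX₀, hnp⟩, hmin⟩ := exists_minimalFor_of_wellFoundedLT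
    (fun X : Set V => X.Finite ∧ ¬ IsPrincipalUF (tangleUF G τ X)) Set.ncard h
  have hleast : ∀ X : Set V, X.Finite → ¬ IsPrincipalUF (tangleUF G τ X) → X₀ ⊆ X := by
    intro X hX hXnp
    have hfin : (X₀ ∩ X).Finite := hX₀.subset inter_subset_left
    have hinter : ¬ IsPrincipalUF (tangleUF G τ (X₀ ∩ X)) := by
      rw [hiff _ hfin]
      rintro ⟨v, hv⟩
      rcases exists_compOf_mem_of_inter hfree hX₀ hX hv with h | h
      · exact hnp ((hiff _ hX₀).2 h)
      · exact hXnp ((hiff _ hX).2 h)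
    have hle := hmin ⟨hfin, hinter⟩ (ncard_le_ncard inter_subset_left hX₀)
    exact inter_eq_left.1 (eq_of_subset_of_ncard_le inter_subset_left hle hX₀)
  refine ⟨X₀, hX₀, hnp, hleast, Set.ext fun X => ⟨fun hX => ⟨hX.1, hleast X hX.1 hX.2⟩, ?_⟩⟩
  rintro ⟨hX, hsub⟩
  refine ⟨hX, fun hp => hnp ?_⟩
  obtain ⟨v, hv⟩ := (hiff X hX).1 hp
  exact (hiff _ hX₀).2 ⟨v, Filter.mem_of_superset hv (compOf_anti G hsub v)⟩
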